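/- Let N ≥ 1 and let Ω₁, Ω₂ ⊂ ℝ^N be nonempty bounded open connected sets with disjoint closures. Let μ⁻ be a finite nonnegative Borel measure on [0,1] with μ⁻((0,1)) > 0. For a nonempty open set U ⊂ ℝ^N define λ(U) := inf { (∫_U |∇u(x)|² dx) / (∫_{[0,1)} [u]_s² dμ⁻(s)) : u ∈ A(U), ∫_U |∇u|² dx < ∞, 0 < ∫_{[0,1)} [u]_s² dμ⁻(s) < ∞ }. Assume that for each j ∈ {1,2} there exists u_j ∈ A(Ω_j) with u_j ≥ 0, u_j not identically zero, ∫_{Ω_j}|∇u_j|²dx < ∞ and 0 < ∫_{[0,1)}[u_j]_s²dμ⁻(s) < ∞, whose quotient attains λ(Ω_j). Then for every c₁, c₂ ≥ 0 with (c₁,c₂) ≠ (0,0), the function v := c₁u₁ + c₂u₂ satisfies (∫_{Ω₁∪Ω₂}|∇v(x)|²dx)/(∫_{[0,1)}[v]_s²dμ⁻(s)) > λ(Ω₁ ∪ Ω₂); in particular, no nonnegative linear combination of u₁ and u₂ attains the infimum λ(Ω₁ ∪ Ω₂). -/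

import Mathlib

open MeasureTheory Filter Topology
open scoped ENNReal

noncomputable def cNs (N : ℕ) (s : ℝ) : ℝ :=
  (2 ^ (2 * s - 1) * Real.Gamma ((N + 2 * s) / 2) * (s * (1 - s))) /
    (Real.pi ^ ((N : ℝ) / 2) * Real.Gamma (2 - s))

/-- Squared Gagliardo seminorm `[u]_s²`, with the convention `[u]_0 = ‖u‖_{L²}`. -/
noncomputable def gagSq (N : ℕ) (u : EuclideanSpace ℝ (Fin N) → ℝ) (s : ℝ) : ℝ≥0∞ :=
  if s = 0 then ∫⁻ x, ENNReal.ofReal (u x ^ 2)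
  else ENNReal.ofReal (cNs N s) *
    ∫⁻ x, ∫⁻ y, ENNReal.ofReal ((u x - u y) ^ 2 / ‖x - y‖ ^ ((N : ℝ) + 2 * s))

/-- `A(U)`: continuous on `ℝ^N`, continuously differentiable on `U`, zero outside `U`. -/
def memA (N : ℕ) (U : Set (EuclideanSpace ℝ (Fin N))) (u : EuclideanSpace ℝ (Fin N) → ℝ) : Prop :=
  Continuous u ∧ ContDiffOn ℝ 1 u U ∧ ∀ x ∉ U, u x = 0

/-- The denominator `∫_{[0,1)} [u]_s² dμ⁻(s)`. -/
noncomputable def denom (N : ℕ) (μm : Measure ℝ) (u : EuclideanSpace ℝ (Fin N) → ℝ) : ℝ≥0∞ :=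
  ∫⁻ s in Set.Ico (0 : ℝ) 1, gagSq N u s ∂μm

/-- Admissibility for the Rayleigh quotient on `U`. -/
def admissible (N : ℕ) (μm : Measure ℝ) (U : Set (EuclideanSpace ℝ (Fin N)))
    (u : EuclideanSpace ℝ (Fin N) → ℝ) : Prop :=
  memA N U u ∧ IntegrableOn (fun x => ‖fderiv ℝ u x‖ ^ 2) U volume ∧
    0 < denom N μm u ∧ denom N μm u < ⊤

/-- The Rayleigh quotient. -/
noncomputable def rayleigh (N : ℕ) (μm : Measure ℝ) (U : Set (EuclideanSpace ℝ (Fin N)))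
    (u : EuclideanSpace ℝ (Fin N) → ℝ) : ℝ :=
  (∫ x in U, ‖fderiv ℝ u x‖ ^ 2) / (denom N μm u).toReal

/-- The first "eigenvalue" `λ(U)`. -/
noncomputable def lam (N : ℕ) (μm : Measure ℝ) (U : Set (EuclideanSpace ℝ (Fin N))) : ℝ :=
  sInf { r : ℝ | ∃ u, admissible N μm U u ∧ r = rayleigh N μm U u }

/-- The energy of a zeroth-order density `g` and an interaction density `G`; the squared seminorm
`gagSq N u` is the case `g = u²`, `G x y = (u x - u y)²`. -/
noncomputable def pairForm (N : ℕ) (g : EuclideanSpace ℝ (Fin N) → ℝ)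
    (G : EuclideanSpace ℝ (Fin N) → EuclideanSpace ℝ (Fin N) → ℝ) (s : ℝ) : ℝ≥0∞ :=
  if s = 0 then ∫⁻ x, ENNReal.ofReal (g x)
  else ENNReal.ofReal (cNs N s) *
    ∫⁻ x, ∫⁻ y, ENNReal.ofReal (G x y / ‖x - y‖ ^ ((N : ℝ) + 2 * s))

/-- The energy `pairForm` integrated over `s ∈ [0, 1)`. -/
noncomputable def pairEnergy (N : ℕ) (μm : Measure ℝ) (g : EuclideanSpace ℝ (Fin N) → ℝ)
    (G : EuclideanSpace ℝ (Fin N) → EuclideanSpace ℝ (Fin N) → ℝ) : ℝ≥0∞ :=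
  ∫⁻ s in Set.Ico (0 : ℝ) 1, pairForm N g G s ∂μm

section Energy

variable {N : ℕ} {μm : Measure ℝ} {g g' : EuclideanSpace ℝ (Fin N) → ℝ}
  {G G' : EuclideanSpace ℝ (Fin N) → EuclideanSpace ℝ (Fin N) → ℝ}

theorem denom_eq_pairEnergy (u : EuclideanSpace ℝ (Fin N) → ℝ) :
    denom N μm u = pairEnergy N μm (fun x => u x ^ 2) (fun x y => (u x - u y) ^ 2) := rfl

theorem cNs_pos (hN : 1 ≤ N) {s : ℝ} (hs : s ∈ Set.Ioo (0 : ℝ) 1) : 0 < cNs N s := by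
  have hN' : (1 : ℝ) ≤ N := by exact_mod_cast hN
  have h1 : 0 < Real.Gamma ((N + 2 * s) / 2) := Real.Gamma_pos_of_pos (by linarith [hs.1])
  have h2 : 0 < Real.Gamma (2 - s) := Real.Gamma_pos_of_pos (by linarith [hs.2])
  have h3 : 0 < s * (1 - s) := mul_pos hs.1 (by linarith [hs.2])
  unfold cNs
  positivity

theorem continuousOn_cNs (hN : 1 ≤ N) : ContinuousOn (cNs N) (Set.Ico 0 1) := by
  have hN' : (1 : ℝ) ≤ N := by exact_mod_cast hN
  intro s hs
  apply ContinuousAt.continuousWithinAt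
  have hΓ : ∀ t : ℝ, 0 < t → ContinuousAt Real.Gamma t := fun t ht =>
    (Real.differentiableAt_Gamma fun m => by
      have : (0 : ℝ) ≤ m := m.cast_nonneg
      linarith).continuousAt
  have h1 : ContinuousAt (fun s : ℝ => Real.Gamma ((N + 2 * s) / 2)) s :=
    ContinuousAt.comp (g := Real.Gamma) (hΓ _ (by linarith [hs.1])) (by fun_prop)
  have h2 : ContinuousAt (fun s : ℝ => Real.Gamma (2 - s)) s :=
    ContinuousAt.comp (g := Real.Gamma) (hΓ _ (by linarith [hs.2])) (by fun_prop)
  have h3 : ContinuousAt (fun s : ℝ => (2 : ℝ) ^ (2 * s - 1)) s :=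
    (Real.continuous_const_rpow two_ne_zero).continuousAt.comp
      (f := fun s : ℝ => 2 * s - 1) (by fun_prop)
  have h4 : 0 < Real.Gamma (2 - s) := Real.Gamma_pos_of_pos (by linarith [hs.2])
  have h5 : Real.pi ^ ((N : ℝ) / 2) * Real.Gamma (2 - s) ≠ 0 := by positivity
  exact ((h3.mul h1).mul (by fun_prop)).div (continuousAt_const.mul h2) h5

theorem measurable_pairKernel (hG : Measurable (Function.uncurry G)) :
    Measurable fun p : (ℝ × EuclideanSpace ℝ (Fin N)) × EuclideanSpace ℝ (Fin N) =>
      ENNReal.ofReal (G p.1.2 p.2 / ‖p.1.2 - p.2‖ ^ ((N : ℝ) + 2 * p.1.1)) := by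
  have h : Measurable fun p : (ℝ × EuclideanSpace ℝ (Fin N)) × EuclideanSpace ℝ (Fin N) =>
      G p.1.2 p.2 := hG.comp (by fun_prop :
        Measurable fun p : (ℝ × EuclideanSpace ℝ (Fin N)) × EuclideanSpace ℝ (Fin N) =>
          (p.1.2, p.2))
  fun_prop

theorem measurable_pairKernel_lintegral (hG : Measurable (Function.uncurry G)) :
    Measurable fun p : ℝ × EuclideanSpace ℝ (Fin N) =>
      ∫⁻ y, ENNReal.ofReal (G p.2 y / ‖p.2 - y‖ ^ ((N : ℝ) + 2 * p.1)) :=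
  (measurable_pairKernel hG).lintegral_prod_right'

theorem aemeasurable_pairForm (hN : 1 ≤ N) (hG : Measurable (Function.uncurry G)) :
    AEMeasurable (pairForm N g G) (μm.restrict (Set.Ico 0 1)) := by
  have hc : AEMeasurable (fun s => ENNReal.ofReal (cNs N s)) (μm.restrict (Set.Ico 0 1)) :=
    ((continuousOn_cNs hN).aemeasurable measurableSet_Ico).ennreal_ofReal
  have hK := (measurable_pairKernel_lintegral hG).lintegral_prod_right' (ν := volume)
  have h := hc.mul hK.aemeasurable
  refine ⟨fun s => if s = 0 then ∫⁻ x, ENNReal.ofReal (g x) else h.mk _ s,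
    Measurable.ite (measurableSet_singleton (0 : ℝ)) measurable_const h.measurable_mk, ?_⟩
  filter_upwards [h.ae_eq_mk] with s hs
  simp only [pairForm]
  split_ifs
  · rfl
  · exact hs

theorem pairForm_add (hg : Measurable g) (hG : Measurable (Function.uncurry G))
    (hg0 : ∀ x, 0 ≤ g x) (hg0' : ∀ x, 0 ≤ g' x) (hG0 : ∀ x y, 0 ≤ G x y)
    (hG0' : ∀ x y, 0 ≤ G' x y) (s : ℝ) :
    pairForm N (fun x => g x + g' x) (fun x y => G x y + G' x y) s =
      pairForm N g G s + pairForm N g' G' s := by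
  unfold pairForm
  split_ifs
  · rw [← lintegral_add_left hg.ennreal_ofReal]
    exact lintegral_congr fun x => ENNReal.ofReal_add (hg0 x) (hg0' x)
  · have hx : Measurable fun x => ∫⁻ y, ENNReal.ofReal (G x y / ‖x - y‖ ^ ((N : ℝ) + 2 * s)) :=
      (measurable_pairKernel_lintegral hG).comp (by fun_prop : Measurable fun x => (s, x))
    rw [← mul_add, ← lintegral_add_left hx]
    congr 1
    refine lintegral_congr fun x => ?_
    have hy : Measurable fun y => ENNReal.ofReal (G x y / ‖x - y‖ ^ ((N : ℝ) + 2 * s)) :=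
      (measurable_pairKernel hG).comp (by fun_prop : Measurable fun y => ((s, x), y))
    rw [← lintegral_add_left hy]
    refine lintegral_congr fun y => ?_
    have hp : 0 ≤ ‖x - y‖ ^ ((N : ℝ) + 2 * s) := Real.rpow_nonneg (norm_nonneg _) _
    rw [add_div, ENNReal.ofReal_add (div_nonneg (hG0 x y) hp) (div_nonneg (hG0' x y) hp)]

theorem pairEnergy_add (hN : 1 ≤ N) (hg : Measurable g) (hG : Measurable (Function.uncurry G))
    (hg0 : ∀ x, 0 ≤ g x) (hg0' : ∀ x, 0 ≤ g' x) (hG0 : ∀ x y, 0 ≤ G x y)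
    (hG0' : ∀ x y, 0 ≤ G' x y) :
    pairEnergy N μm (fun x => g x + g' x) (fun x y => G x y + G' x y) =
      pairEnergy N μm g G + pairEnergy N μm g' G' := by
  unfold pairEnergy
  rw [← lintegral_add_left' (aemeasurable_pairForm hN hG)]
  exact lintegral_congr fun s => pairForm_add hg hG hg0 hg0' hG0 hG0' s

theorem pairForm_const_mul {a : ℝ} (ha : 0 ≤ a) (s : ℝ) :
    pairForm N (fun x => a * g x) (fun x y => a * G x y) s =
      ENNReal.ofReal a * pairForm N g G s := by
  unfold pairForm
  split_ifs
  · rw [← lintegral_const_mul' _ _ ENNReal.ofReal_ne_top]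
    exact lintegral_congr fun x => ENNReal.ofReal_mul ha
  · rw [mul_left_comm]
    congr 1
    rw [← lintegral_const_mul' _ _ ENNReal.ofReal_ne_top]
    refine lintegral_congr fun x => ?_
    rw [← lintegral_const_mul' _ _ ENNReal.ofReal_ne_top]
    refine lintegral_congr fun y => ?_
    rw [mul_div_assoc, ENNReal.ofReal_mul ha]

theorem pairEnergy_const_mul {a : ℝ} (ha : 0 ≤ a) :
    pairEnergy N μm (fun x => a * g x) (fun x y => a * G x y) =
      ENNReal.ofReal a * pairEnergy N μm g G := by
  unfold pairEnergy
  rw [← lintegral_const_mul' _ _ ENNReal.ofReal_ne_top]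
  exact lintegral_congr fun s => pairForm_const_mul ha s

theorem lintegral_pos_of_isOpen {f : EuclideanSpace ℝ (Fin N) → ℝ≥0∞} (hf : Measurable f)
    {U : Set (EuclideanSpace ℝ (Fin N))} (hU : IsOpen U) (hne : U.Nonempty)
    (h : ∀ x ∈ U, 0 < f x) : 0 < ∫⁻ x, f x := by
  rw [lintegral_pos_iff_support hf]
  exact (hU.measure_pos volume hne).trans_le (measure_mono fun x hx => (h x hx).ne')

theorem pairEnergy_pos (hN : 1 ≤ N) (hμ : 0 < μm (Set.Ioo 0 1))
    (hG : Measurable (Function.uncurry G)) {U V : Set (EuclideanSpace ℝ (Fin N))}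
    (hU : IsOpen U) (hV : IsOpen V) (hUne : U.Nonempty) (hVne : V.Nonempty)
    (hUV : Disjoint U V) (hpos : ∀ x ∈ U, ∀ y ∈ V, 0 < G x y) :
    0 < pairEnergy N μm g G := by
  have key : ∀ s ∈ Set.Ioo (0 : ℝ) 1, 0 < pairForm N g G s := by
    intro s hs
    rw [pairForm, if_neg hs.1.ne']
    refine ENNReal.mul_pos (ENNReal.ofReal_pos.2 (cNs_pos hN hs)).ne' (ne_of_gt ?_)
    refine lintegral_pos_of_isOpen
      ((measurable_pairKernel_lintegral hG).comp (by fun_prop : Measurable fun x => (s, x)))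
      hU hUne fun x hx => ?_
    refine lintegral_pos_of_isOpen
      ((measurable_pairKernel hG).comp (by fun_prop : Measurable fun y => ((s, x), y)))
      hV hVne fun y hy => ?_
    have hxy : 0 < ‖x - y‖ := norm_pos_iff.2 (sub_ne_zero.2 (hUV.ne_of_mem hx hy))
    exact ENNReal.ofReal_pos.2 (div_pos (hpos x hx y hy) (Real.rpow_pos_of_pos hxy _))
  have hm : AEMeasurable (pairForm N g G) (μm.restrict (Set.Ico 0 1)) :=
    aemeasurable_pairForm hN hG
  refine pos_iff_ne_zero.2 fun h0 => ?_
  have h1 := (lintegral_eq_zero_iff' hm).1 h0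
  have h2 : ∀ᵐ s ∂μm.restrict (Set.Ioo 0 1), pairForm N g G s = 0 :=
    ae_restrict_of_ae_restrict_of_subset Set.Ioo_subset_Ico_self h1
  have h3 : ∀ᵐ s ∂μm.restrict (Set.Ioo (0 : ℝ) 1), False := by
    filter_upwards [h2, ae_restrict_mem measurableSet_Ioo] with s hs hs'
    exact (key s hs').ne' hs
  rw [eventually_false_iff_eq_bot, ae_eq_bot, Measure.restrict_eq_zero] at h3
  exact hμ.ne' h3

end Energy

section Combination

variable {N : ℕ} {μm : Measure ℝ} {u₁ u₂ : EuclideanSpace ℝ (Fin N) → ℝ}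

/-- The interaction energy of two functions of disjoint supports. -/
noncomputable def crossEnergy (N : ℕ) (μm : Measure ℝ)
    (u₁ u₂ : EuclideanSpace ℝ (Fin N) → ℝ) : ℝ≥0∞ :=
  pairEnergy N μm (fun _ => 0) (fun x y => 2 * (u₁ x * u₂ y + u₁ y * u₂ x))

theorem measurable_sq_sub {u : EuclideanSpace ℝ (Fin N) → ℝ} (hu : Continuous u) :
    Measurable (Function.uncurry fun x y => (u x - u y) ^ 2) := by
  have : Continuous (Function.uncurry fun x y => (u x - u y) ^ 2) := by
    unfold Function.uncurry; fun_prop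
  exact this.measurable

theorem denom_const_mul {a : ℝ} (u : EuclideanSpace ℝ (Fin N) → ℝ) :
    denom N μm (fun x => a * u x) = ENNReal.ofReal (a ^ 2) * denom N μm u := by
  simp only [denom_eq_pairEnergy]
  rw [← pairEnergy_const_mul (sq_nonneg a)]
  congr 1
  · ext x; ring
  · ext x y; ring

theorem denom_sq_add_sq (hN : 1 ≤ N) (hu₁ : Continuous u₁) (a b : ℝ) :
    ENNReal.ofReal (a ^ 2) * denom N μm u₁ + ENNReal.ofReal (b ^ 2) * denom N μm u₂ =
      pairEnergy N μm (fun x => (a * u₁ x) ^ 2 + (b * u₂ x) ^ 2)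
        (fun x y => (a * u₁ x - a * u₁ y) ^ 2 + (b * u₂ x - b * u₂ y) ^ 2) := by
  rw [← denom_const_mul, ← denom_const_mul, denom_eq_pairEnergy, denom_eq_pairEnergy,
    ← pairEnergy_add hN (by fun_prop) (measurable_sq_sub (by fun_prop)) (fun _ => sq_nonneg _)
      (fun _ => sq_nonneg _) (fun _ _ => sq_nonneg _) (fun _ _ => sq_nonneg _)]

theorem denom_sub (hN : 1 ≤ N) (hu₁ : Continuous u₁) (hu₂ : Continuous u₂)
    (h₁ : ∀ x, 0 ≤ u₁ x) (h₂ : ∀ x, 0 ≤ u₂ x) (h₁₂ : ∀ x, u₁ x * u₂ x = 0)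
    {a b : ℝ} (ha : 0 ≤ a) (hb : 0 ≤ b) :
    denom N μm (fun x => a * u₁ x - b * u₂ x) =
      ENNReal.ofReal (a ^ 2) * denom N μm u₁ + ENNReal.ofReal (b ^ 2) * denom N μm u₂ +
        ENNReal.ofReal (a * b) * crossEnergy N μm u₁ u₂ := by
  have hm : Measurable (Function.uncurry fun x y =>
      (a * u₁ x - a * u₁ y) ^ 2 + (b * u₂ x - b * u₂ y) ^ 2) :=
    (measurable_sq_sub (u := fun x => a * u₁ x) (by fun_prop)).add
      (measurable_sq_sub (u := fun x => b * u₂ x) (by fun_prop))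
  rw [denom_sq_add_sq hN hu₁, crossEnergy, ← pairEnergy_const_mul (mul_nonneg ha hb),
    denom_eq_pairEnergy, ← pairEnergy_add hN (by fun_prop) hm (fun _ => by positivity)
      (fun _ => by simp) (fun _ _ => by positivity)
      (fun x y => by have := h₁ x; have := h₁ y; have := h₂ x; have := h₂ y; positivity)]
  congr 1
  · ext x; linear_combination (-2 * a * b) * h₁₂ x
  · ext x y; linear_combination (-2 * a * b) * (h₁₂ x + h₁₂ y)

theorem denom_add (hN : 1 ≤ N) (hu₁ : Continuous u₁) (hu₂ : Continuous u₂)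
    (h₁ : ∀ x, 0 ≤ u₁ x) (h₂ : ∀ x, 0 ≤ u₂ x) (h₁₂ : ∀ x, u₁ x * u₂ x = 0)
    {a b : ℝ} (ha : 0 ≤ a) (hb : 0 ≤ b) :
    denom N μm (fun x => a * u₁ x + b * u₂ x) +
        ENNReal.ofReal (a * b) * crossEnergy N μm u₁ u₂ =
      ENNReal.ofReal (a ^ 2) * denom N μm u₁ + ENNReal.ofReal (b ^ 2) * denom N μm u₂ := by
  rw [denom_sq_add_sq hN hu₁, crossEnergy, ← pairEnergy_const_mul (mul_nonneg ha hb),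
    denom_eq_pairEnergy, ← pairEnergy_add hN (by fun_prop) (measurable_sq_sub (by fun_prop))
      (fun _ => by positivity)
      (fun _ => by simp) (fun _ _ => by positivity)
      (fun x y => by have := h₁ x; have := h₁ y; have := h₂ x; have := h₂ y; positivity)]
  congr 1
  · ext x; linear_combination (2 * a * b) * h₁₂ x
  · ext x y; linear_combination (2 * a * b) * (h₁₂ x + h₁₂ y)

theorem crossEnergy_pos (hN : 1 ≤ N) (hμ : 0 < μm (Set.Ioo 0 1)) (hu₁ : Continuous u₁)
    (hu₂ : Continuous u₂) (h₁ : ∀ x, 0 ≤ u₁ x) (h₂ : ∀ x, 0 ≤ u₂ x)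
    (h₁₂ : ∀ x, u₁ x * u₂ x = 0) (hne₁ : u₁ ≠ 0) (hne₂ : u₂ ≠ 0) :
    0 < crossEnergy N μm u₁ u₂ := by
  obtain ⟨x₀, hx₀⟩ := Function.ne_iff.1 hne₁
  obtain ⟨y₀, hy₀⟩ := Function.ne_iff.1 hne₂
  have hc : Continuous (Function.uncurry fun x y => 2 * (u₁ x * u₂ y + u₁ y * u₂ x)) := by
    unfold Function.uncurry; fun_prop
  refine pairEnergy_pos hN hμ hc.measurable (U := {x | 0 < u₁ x}) (V := {x | 0 < u₂ x})
    (isOpen_lt continuous_const hu₁) (isOpen_lt continuous_const hu₂)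
    ⟨x₀, (h₁ x₀).lt_of_ne' hx₀⟩ ⟨y₀, (h₂ y₀).lt_of_ne' hy₀⟩ ?_ ?_
  · exact Set.disjoint_left.2 fun x hx hx' => (mul_pos hx hx').ne' (h₁₂ x)
  · intro x hx y hy
    have h := mul_pos (show 0 < u₁ x from hx) (show 0 < u₂ y from hy)
    have h' := mul_nonneg (h₁ y) (h₂ x)
    linarith

theorem denom_pos_of_isBounded (hN : 1 ≤ N) (hμ : 0 < μm (Set.Ioo 0 1))
    {U : Set (EuclideanSpace ℝ (Fin N))} (hU : Bornology.IsBounded U)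
    {u : EuclideanSpace ℝ (Fin N) → ℝ} (hu : Continuous u) (hu0 : ∀ x ∉ U, u x = 0)
    {x₀ : EuclideanSpace ℝ (Fin N)} (hx₀ : u x₀ ≠ 0) : 0 < denom N μm u := by
  have : Nonempty (Fin N) := ⟨⟨0, hN⟩⟩
  have hne : (closure U)ᶜ.Nonempty := by
    refine Set.nonempty_compl.2 fun h => ?_
    exact NormedSpace.unbounded_univ ℝ (EuclideanSpace ℝ (Fin N)) (h ▸ hU.closure)
  rw [denom_eq_pairEnergy]
  have h0 : ∀ x ∈ (closure U)ᶜ, u x = 0 := fun x hx => hu0 x fun h => hx (subset_closure h)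
  refine pairEnergy_pos hN hμ (measurable_sq_sub hu) (U := {x | u x ≠ 0})
    (isOpen_ne_fun hu continuous_const) isClosed_closure.isOpen_compl ⟨x₀, hx₀⟩ hne ?_ ?_
  · exact Set.disjoint_left.2 fun x hx hx' => hx (h0 x hx')
  · intro x hx y hy
    rw [h0 y hy, sub_zero]
    exact sq_pos_of_ne_zero hx

end Combination

theorem dirichlet_pos {N : ℕ} (hN : 1 ≤ N) {U : Set (EuclideanSpace ℝ (Fin N))}
    (hUo : IsOpen U) (hUb : Bornology.IsBounded U) (hUc : IsConnected U)
    {u : EuclideanSpace ℝ (Fin N) → ℝ} (hu : memA N U u)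
    (hint : IntegrableOn (fun x => ‖fderiv ℝ u x‖ ^ 2) U volume) (hne : u ≠ 0) :
    0 < ∫ x in U, ‖fderiv ℝ u x‖ ^ 2 := by
  have : Nonempty (Fin N) := ⟨⟨0, hN⟩⟩
  obtain ⟨hc, hd, h0⟩ := hu
  refine (integral_nonneg fun x => sq_nonneg _).lt_of_ne' fun hz => hne ?_
  have hae := (integral_eq_zero_iff_of_nonneg (fun x => sq_nonneg _) hint).1 hz
  have hcd : ContinuousOn (fderiv ℝ u) U := hd.continuousOn_fderiv_of_isOpen hUo le_rfl
  have heq : Set.EqOn (fun x => ‖fderiv ℝ u x‖ ^ 2) 0 U :=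
    Measure.eqOn_open_of_ae_eq hae hUo (hcd.norm.pow 2) continuousOn_const
  obtain ⟨k, hk⟩ := hUo.exists_is_const_of_fderiv_eq_zero hUc.isPreconnected
    (hd.differentiableOn one_ne_zero) fun x hx => by simpa using heq hx
  have huniv : U ≠ Set.univ := fun h =>
    NormedSpace.unbounded_univ ℝ (EuclideanSpace ℝ (Fin N)) (h ▸ hUb)
  obtain ⟨p, hp⟩ := nonempty_frontier_iff.2 ⟨hUc.nonempty, huniv⟩
  rw [hUo.frontier_eq] at hp
  have hkp : u p = k := by
    have : Set.EqOn u (fun _ => k) (closure U) :=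
      Set.EqOn.closure (fun x hx => hk x hx) hc continuous_const
    exact this hp.1
  ext x
  by_cases hx : x ∈ U
  · rw [hk x hx, ← hkp, h0 p hp.2]; rfl
  · exact h0 x hx

section Union

variable {N : ℕ} {U₁ U₂ : Set (EuclideanSpace ℝ (Fin N))} {u₁ u₂ : EuclideanSpace ℝ (Fin N) → ℝ}

theorem combination_eventuallyEq (hU₁ : IsOpen U₁) (hd : Disjoint U₁ U₂)
    (h₂ : ∀ x ∉ U₂, u₂ x = 0) (a b : ℝ) {x : EuclideanSpace ℝ (Fin N)} (hx : x ∈ U₁) :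
    (fun x => a * u₁ x + b * u₂ x) =ᶠ[𝓝 x] fun x => a * u₁ x := by
  filter_upwards [hU₁.mem_nhds hx] with y hy
  rw [h₂ y (Set.disjoint_left.1 hd hy), mul_zero, add_zero]

theorem norm_fderiv_combination_sq (hU₁ : IsOpen U₁) (hd : Disjoint U₁ U₂)
    (h₂ : ∀ x ∉ U₂, u₂ x = 0) (a b : ℝ) {x : EuclideanSpace ℝ (Fin N)} (hx : x ∈ U₁) :
    ‖fderiv ℝ (fun x => a * u₁ x + b * u₂ x) x‖ ^ 2 = a ^ 2 * ‖fderiv ℝ u₁ x‖ ^ 2 := by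
  rw [(combination_eventuallyEq hU₁ hd h₂ a b hx).fderiv_eq]
  have : fderiv ℝ (fun x => a * u₁ x) x = a • fderiv ℝ u₁ x :=
    congrFun (fderiv_const_smul_field (𝕜 := ℝ) (f := u₁) a) x
  rw [this, norm_smul, mul_pow, Real.norm_eq_abs, sq_abs]

theorem contDiffAt_combination (hU₁ : IsOpen U₁) (hd : Disjoint U₁ U₂) (h₁ : memA N U₁ u₁)
    (h₂ : memA N U₂ u₂) (a b : ℝ) {x : EuclideanSpace ℝ (Fin N)} (hx : x ∈ U₁) :
    ContDiffAt ℝ 1 (fun x => a * u₁ x + b * u₂ x) x :=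
  (contDiffAt_const.mul (h₁.2.1.contDiffAt (hU₁.mem_nhds hx))).congr_of_eventuallyEq
    (combination_eventuallyEq hU₁ hd h₂.2.2 a b hx)

theorem memA_combination (hU₁ : IsOpen U₁) (hU₂ : IsOpen U₂) (hd : Disjoint U₁ U₂)
    (h₁ : memA N U₁ u₁) (h₂ : memA N U₂ u₂) (a b : ℝ) :
    memA N (U₁ ∪ U₂) (fun x => a * u₁ x + b * u₂ x) := by
  have hc₁ := h₁.1
  have hc₂ := h₂.1
  refine ⟨by fun_prop, ?_, ?_⟩
  · rintro x (hx | hx)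
    · exact (contDiffAt_combination hU₁ hd h₁ h₂ a b hx).contDiffWithinAt
    · have := contDiffAt_combination hU₂ hd.symm h₂ h₁ b a hx
      simp only [add_comm (b * _)] at this
      exact this.contDiffWithinAt
  · intro x hx
    rw [Set.mem_union, not_or] at hx
    simp [h₁.2.2 x hx.1, h₂.2.2 x hx.2]

theorem norm_fderiv_combination_sq' (hU₂ : IsOpen U₂) (hd : Disjoint U₁ U₂)
    (h₁ : ∀ x ∉ U₁, u₁ x = 0) (a b : ℝ) {x : EuclideanSpace ℝ (Fin N)} (hx : x ∈ U₂) :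
    ‖fderiv ℝ (fun x => a * u₁ x + b * u₂ x) x‖ ^ 2 = b ^ 2 * ‖fderiv ℝ u₂ x‖ ^ 2 := by
  have := norm_fderiv_combination_sq (u₁ := u₂) hU₂ hd.symm h₁ b a hx
  simpa only [add_comm (b * _)] using this

theorem integrableOn_combination (hU₁ : IsOpen U₁) (hU₂ : IsOpen U₂) (hd : Disjoint U₁ U₂)
    (h₁ : ∀ x ∉ U₁, u₁ x = 0) (h₂ : ∀ x ∉ U₂, u₂ x = 0)
    (hi₁ : IntegrableOn (fun x => ‖fderiv ℝ u₁ x‖ ^ 2) U₁ volume)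
    (hi₂ : IntegrableOn (fun x => ‖fderiv ℝ u₂ x‖ ^ 2) U₂ volume) (a b : ℝ) :
    IntegrableOn (fun x => ‖fderiv ℝ (fun x => a * u₁ x + b * u₂ x) x‖ ^ 2) U₁ volume ∧
    IntegrableOn (fun x => ‖fderiv ℝ (fun x => a * u₁ x + b * u₂ x) x‖ ^ 2) U₂ volume :=
  ⟨IntegrableOn.congr_fun (hi₁.const_mul (a ^ 2))
      (fun _ hx => (norm_fderiv_combination_sq hU₁ hd h₂ a b hx).symm) hU₁.measurableSet,
    IntegrableOn.congr_fun (hi₂.const_mul (b ^ 2))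
      (fun _ hx => (norm_fderiv_combination_sq' hU₂ hd h₁ a b hx).symm) hU₂.measurableSet⟩

theorem dirichlet_combination (hU₁ : IsOpen U₁) (hU₂ : IsOpen U₂) (hd : Disjoint U₁ U₂)
    (h₁ : ∀ x ∉ U₁, u₁ x = 0) (h₂ : ∀ x ∉ U₂, u₂ x = 0)
    (hi₁ : IntegrableOn (fun x => ‖fderiv ℝ u₁ x‖ ^ 2) U₁ volume)
    (hi₂ : IntegrableOn (fun x => ‖fderiv ℝ u₂ x‖ ^ 2) U₂ volume) (a b : ℝ) :
    ∫ x in U₁ ∪ U₂, ‖fderiv ℝ (fun x => a * u₁ x + b * u₂ x) x‖ ^ 2 =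
      a ^ 2 * (∫ x in U₁, ‖fderiv ℝ u₁ x‖ ^ 2) + b ^ 2 * ∫ x in U₂, ‖fderiv ℝ u₂ x‖ ^ 2 := by
  obtain ⟨hw₁, hw₂⟩ := integrableOn_combination hU₁ hU₂ hd h₁ h₂ hi₁ hi₂ a b
  rw [setIntegral_union hd hU₂.measurableSet hw₁ hw₂,
    setIntegral_congr_fun hU₁.measurableSet
      fun _ hx => norm_fderiv_combination_sq hU₁ hd h₂ a b hx,
    setIntegral_congr_fun hU₂.measurableSet
      fun _ hx => norm_fderiv_combination_sq' hU₂ hd h₁ a b hx,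
    integral_const_mul, integral_const_mul]

end Union

theorem lam_le_rayleigh {N : ℕ} {μm : Measure ℝ} {U : Set (EuclideanSpace ℝ (Fin N))}
    {u : EuclideanSpace ℝ (Fin N) → ℝ} (hu : admissible N μm U u) :
    lam N μm U ≤ rayleigh N μm U u := by
  refine csInf_le ⟨0, ?_⟩ ⟨u, hu, rfl⟩
  rintro _ ⟨w, -, rfl⟩
  exact div_nonneg (integral_nonneg fun x => sq_nonneg _) ENNReal.toReal_nonneg

/-- Flipping the sign of the cross term strictly lowers a quotient of quadratic forms. -/
theorem exists_quotient_lt {D₁ D₂ B₁ B₂ E c₁ c₂ B : ℝ} (hD₁ : 0 < D₁) (hD₂ : 0 < D₂)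
    (hB₁ : 0 < B₁) (hB₂ : 0 < B₂) (hE : 0 < E) (hc₁ : 0 ≤ c₁) (hc₂ : 0 ≤ c₂)
    (hc : (c₁, c₂) ≠ (0, 0)) (hB : 0 < B)
    (hBeq : B + c₁ * c₂ * E = c₁ ^ 2 * B₁ + c₂ ^ 2 * B₂) :
    ∃ a b : ℝ, 0 < a ∧ 0 < b ∧
      (a ^ 2 * D₁ + b ^ 2 * D₂) / (a ^ 2 * B₁ + b ^ 2 * B₂ + a * b * E) <
        (c₁ ^ 2 * D₁ + c₂ ^ 2 * D₂) / B := by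
  rcases hc₁.eq_or_lt with rfl | hc₁
  · have hc₂ : 0 < c₂ := hc₂.lt_of_ne' fun h => hc (by simp [h])
    have hb : B = c₂ ^ 2 * B₂ := by linarith
    have ha : 0 < D₂ * E / (D₁ * B₂) := by positivity
    refine ⟨D₂ * E / (D₁ * B₂), 1, ha, one_pos, ?_⟩
    generalize hε : D₂ * E / (D₁ * B₂) = ε at ha
    have hε' : ε * (D₁ * B₂) = D₂ * E := by rw [← hε]; field_simp
    have : (0 ^ 2 * D₁ + c₂ ^ 2 * D₂) / B = D₂ / B₂ := by rw [hb]; field_simp; ring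
    rw [this, div_lt_div_iff₀ (by positivity) hB₂]
    have h1 : ε ^ 2 * D₁ * B₂ = ε * (D₂ * E) := by rw [← hε']; ring
    have h2 : 0 < D₂ * (ε ^ 2 * B₁) := by positivity
    nlinarith
  rcases hc₂.eq_or_lt with rfl | hc₂
  · have hb : B = c₁ ^ 2 * B₁ := by linarith
    have ha : 0 < D₁ * E / (D₂ * B₁) := by positivity
    refine ⟨1, D₁ * E / (D₂ * B₁), one_pos, ha, ?_⟩
    generalize hε : D₁ * E / (D₂ * B₁) = ε at ha
    have hε' : ε * (D₂ * B₁) = D₁ * E := by rw [← hε]; field_simp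
    have : (c₁ ^ 2 * D₁ + 0 ^ 2 * D₂) / B = D₁ / B₁ := by rw [hb]; field_simp; ring
    rw [this, div_lt_div_iff₀ (by positivity) hB₁]
    have h1 : ε ^ 2 * D₂ * B₁ = ε * (D₁ * E) := by rw [← hε']; ring
    have h2 : 0 < D₁ * (ε ^ 2 * B₂) := by positivity
    nlinarith
  · refine ⟨c₁, c₂, hc₁, hc₂, ?_⟩
    have h : 0 < c₁ * c₂ * E := by positivity
    exact div_lt_div_of_pos_left (by positivity) hB (by linarith)

theorem stmt3 (N : ℕ) (hN : 1 ≤ N) (Ω₁ Ω₂ : Set (EuclideanSpace ℝ (Fin N)))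
    (h1o : IsOpen Ω₁) (h2o : IsOpen Ω₂) (h1b : Bornology.IsBounded Ω₁)
    (h2b : Bornology.IsBounded Ω₂) (h1c : IsConnected Ω₁) (h2c : IsConnected Ω₂)
    (hdisj : Disjoint (closure Ω₁) (closure Ω₂))
    (μm : Measure ℝ) [IsFiniteMeasure μm] (hμmsupp : μm (Set.Icc 0 1)ᶜ = 0)
    (hμmpos : 0 < μm (Set.Ioo 0 1))
    (u₁ u₂ : EuclideanSpace ℝ (Fin N) → ℝ)
    (h1adm : admissible N μm Ω₁ u₁) (h2adm : admissible N μm Ω₂ u₂)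
    (h1nn : ∀ x, 0 ≤ u₁ x) (h2nn : ∀ x, 0 ≤ u₂ x)
    (h1ne : u₁ ≠ 0) (h2ne : u₂ ≠ 0)
    (h1min : rayleigh N μm Ω₁ u₁ = lam N μm Ω₁)
    (h2min : rayleigh N μm Ω₂ u₂ = lam N μm Ω₂) :
    ∀ c₁ c₂ : ℝ, 0 ≤ c₁ → 0 ≤ c₂ → (c₁, c₂) ≠ (0, 0) →
      lam N μm (Ω₁ ∪ Ω₂) <
        rayleigh N μm (Ω₁ ∪ Ω₂) (fun x => c₁ * u₁ x + c₂ * u₂ x) := by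
  intro c₁ c₂ hc₁ hc₂ hc
  obtain ⟨h1A, h1int, h1pos, h1fin⟩ := h1adm
  obtain ⟨h2A, h2int, h2pos, h2fin⟩ := h2adm
  have hd : Disjoint Ω₁ Ω₂ := hdisj.mono subset_closure subset_closure
  have h12 : ∀ x, u₁ x * u₂ x = 0 := fun x => by
    by_cases hx : x ∈ Ω₁
    · rw [h2A.2.2 x (Set.disjoint_left.1 hd hx), mul_zero]
    · rw [h1A.2.2 x hx, zero_mul]
  have hEpos : 0 < crossEnergy N μm u₁ u₂ :=
    crossEnergy_pos hN hμmpos h1A.1 h2A.1 h1nn h2nn h12 h1ne h2ne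
  have hsum : ∀ a b : ℝ,
      ENNReal.ofReal (a ^ 2) * denom N μm u₁ + ENNReal.ofReal (b ^ 2) * denom N μm u₂ ≠ ⊤ :=
    fun a b => ENNReal.add_ne_top.2 ⟨ENNReal.mul_ne_top ENNReal.ofReal_ne_top h1fin.ne,
      ENNReal.mul_ne_top ENNReal.ofReal_ne_top h2fin.ne⟩
  have hEfin : crossEnergy N μm u₁ u₂ ≠ ⊤ := by
    have h := denom_add (μm := μm) hN h1A.1 h2A.1 h1nn h2nn h12 zero_le_one zero_le_one
    have h' := hsum 1 1
    rw [← h, ENNReal.add_ne_top] at h'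
    simpa using h'.2
  have hsumReal : ∀ a b : ℝ,
      (ENNReal.ofReal (a ^ 2) * denom N μm u₁ + ENNReal.ofReal (b ^ 2) * denom N μm u₂).toReal =
        a ^ 2 * (denom N μm u₁).toReal + b ^ 2 * (denom N μm u₂).toReal := fun a b => by
    rw [ENNReal.toReal_add (ENNReal.add_ne_top.1 (hsum a b)).1
      (ENNReal.add_ne_top.1 (hsum a b)).2, ENNReal.toReal_mul, ENNReal.toReal_mul,
      ENNReal.toReal_ofReal (sq_nonneg a), ENNReal.toReal_ofReal (sq_nonneg b)]
  have hD₁ := dirichlet_pos hN h1o h1b h1c h1A h1int h1ne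
  have hD₂ := dirichlet_pos hN h2o h2b h2c h2A h2int h2ne
  have hAv := memA_combination h1o h2o hd h1A h2A c₁ c₂
  have hvx : ∃ x, c₁ * u₁ x + c₂ * u₂ x ≠ 0 := by
    rcases hc₁.eq_or_lt with rfl | hc₁
    · obtain ⟨x, hx⟩ := Function.ne_iff.1 h2ne
      refine ⟨x, ?_⟩
      have : c₂ ≠ 0 := fun h => hc (by simp [h])
      simpa using ⟨this, hx⟩
    · obtain ⟨x, hx⟩ := Function.ne_iff.1 h1ne
      have := mul_pos hc₁ ((h1nn x).lt_of_ne' hx)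
      exact ⟨x, (add_pos_of_pos_of_nonneg this (mul_nonneg hc₂ (h2nn x))).ne'⟩
  obtain ⟨x₀, hx₀⟩ := hvx
  have hvpos : 0 < denom N μm (fun x => c₁ * u₁ x + c₂ * u₂ x) :=
    denom_pos_of_isBounded hN hμmpos (h1b.union h2b) hAv.1 hAv.2.2 hx₀
  have hv := denom_add (μm := μm) hN h1A.1 h2A.1 h1nn h2nn h12 hc₁ hc₂
  have hvfin : denom N μm (fun x => c₁ * u₁ x + c₂ * u₂ x) ≠ ⊤ := by
    have h' := hsum c₁ c₂
    rw [← hv, ENNReal.add_ne_top] at h'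
    exact h'.1
  have hvReal := congrArg ENNReal.toReal hv
  rw [hsumReal, ENNReal.toReal_add hvfin (ENNReal.mul_ne_top ENNReal.ofReal_ne_top hEfin),
    ENNReal.toReal_mul, ENNReal.toReal_ofReal (mul_nonneg hc₁ hc₂)] at hvReal
  obtain ⟨a, b, ha, hb, hlt⟩ := exists_quotient_lt hD₁ hD₂
    (ENNReal.toReal_pos h1pos.ne' h1fin.ne) (ENNReal.toReal_pos h2pos.ne' h2fin.ne)
    (ENNReal.toReal_pos hEpos.ne' hEfin) hc₁ hc₂ hc (ENNReal.toReal_pos hvpos.ne' hvfin) hvReal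
  have hw : denom N μm (fun x => a * u₁ x + -b * u₂ x) =
      ENNReal.ofReal (a ^ 2) * denom N μm u₁ + ENNReal.ofReal (b ^ 2) * denom N μm u₂ +
        ENNReal.ofReal (a * b) * crossEnergy N μm u₁ u₂ := by
    simpa only [neg_mul, ← sub_eq_add_neg] using
      denom_sub hN h1A.1 h2A.1 h1nn h2nn h12 ha.le hb.le
  have hcross : ENNReal.ofReal (a * b) * crossEnergy N μm u₁ u₂ ≠ ⊤ :=
    ENNReal.mul_ne_top ENNReal.ofReal_ne_top hEfin
  have hwpos : 0 < denom N μm (fun x => a * u₁ x + -b * u₂ x) := by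
    rw [hw]
    exact (ENNReal.mul_pos (ENNReal.ofReal_pos.2 (mul_pos ha hb)).ne' hEpos.ne').trans_le
      le_add_self
  have hwint := integrableOn_combination h1o h2o hd h1A.2.2 h2A.2.2 h1int h2int a (-b)
  have hwadm : admissible N μm (Ω₁ ∪ Ω₂) (fun x => a * u₁ x + -b * u₂ x) :=
    ⟨memA_combination h1o h2o hd h1A h2A a (-b), hwint.1.union hwint.2, hwpos,
      lt_top_iff_ne_top.2 (hw ▸ ENNReal.add_ne_top.2 ⟨hsum a b, hcross⟩)⟩
  refine (lam_le_rayleigh hwadm).trans_lt ?_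
  rw [rayleigh, rayleigh, dirichlet_combination h1o h2o hd h1A.2.2 h2A.2.2 h1int h2int,
    dirichlet_combination h1o h2o hd h1A.2.2 h2A.2.2 h1int h2int, hw,
    ENNReal.toReal_add (hsum a b) hcross, hsumReal, ENNReal.toReal_mul,
    ENNReal.toReal_ofReal (mul_pos ha hb).le, neg_sq]
  exact hlt
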